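/- For all natural numbers ℓ and m with m ≤ ℓ and ℓ − m even, one has ((ℓ−m)! / (ℓ+m)!) · ((ℓ+m)‼)² / ((ℓ−m)‼)² = ∏_{k=1}^{m} (ℓ−m+2k) / (ℓ−m+2k−1), the identity being between rational numbers. -/

import Mathlib

open Nat Finset

theorem factorial_div_mul_doubleFactorial_sq_eq_prod (n m : ℕ) :
    (n ! : ℚ) / ((n + 2 * m)! : ℚ) * ((n + 2 * m)‼ : ℚ) ^ 2 / (n ‼ : ℚ) ^ 2 =
      ∏ k ∈ Finset.Icc 1 m, (((n : ℚ) + 2 * k) / ((n : ℚ) + 2 * k - 1)) := by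
  induction m with
  | zero =>
    have h1 : (n ! : ℚ) ≠ 0 := by exact_mod_cast n.factorial_ne_zero
    have h2 : (n ‼ : ℚ) ≠ 0 := by exact_mod_cast (doubleFactorial_pos n).ne'
    simp [h1, h2]
  | succ m ih =>
    rw [Finset.prod_Icc_succ_top (by omega), ← ih, show n + 2 * (m + 1) = n + 2 * m + 2 by ring,
      doubleFactorial_add_two, Nat.factorial_succ, Nat.factorial_succ]
    have h1 : ((n + 2 * m)! : ℚ) ≠ 0 := by exact_mod_cast Nat.factorial_ne_zero _
    have h2 : (n ‼ : ℚ) ≠ 0 := by exact_mod_cast (doubleFactorial_pos n).ne'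
    have h3 : (n : ℚ) + 2 * m + 1 ≠ 0 := by positivity
    have h4 : (n : ℚ) + 2 * m + 2 ≠ 0 := by positivity
    push_cast
    rw [show (n : ℚ) + 2 * (m + 1) - 1 = n + 2 * m + 1 by ring,
      show (n : ℚ) + 2 * (m + 1) = n + 2 * m + 2 by ring,
      show (n : ℚ) + 2 * m + 1 + 1 = n + 2 * m + 2 by ring]
    field_simp

/-- Telescoping identity for factorials and double factorials: for `m ≤ ℓ` with `ℓ - m` even,
`((ℓ-m)!/(ℓ+m)!) · ((ℓ+m)‼)²/((ℓ-m)‼)² = ∏_{k=1}^m (ℓ-m+2k)/(ℓ-m+2k-1)` in `ℚ`. -/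
theorem stmt_4 (ℓ m : ℕ) (hm : m ≤ ℓ) (he : Even (ℓ - m)) :
    ((ℓ - m)! : ℚ) / ((ℓ + m)! : ℚ) * ((ℓ + m)‼ : ℚ) ^ 2 / ((ℓ - m)‼ : ℚ) ^ 2 =
      ∏ k ∈ Finset.Icc 1 m, (((ℓ : ℚ) - m + 2 * k) / ((ℓ : ℚ) - m + 2 * k - 1)) := by
  have h := factorial_div_mul_doubleFactorial_sq_eq_prod (ℓ - m) m
  rwa [show ℓ - m + 2 * m = ℓ + m by omega, Nat.cast_sub hm] at h
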